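/- For every real number m > 0 with m ≠ 1, on the open set U = {(x,y) ∈ ℝ² : m²x + y > 0}, the functions f(x,y) = m·√(1+m²)/(m²x+y) and k(x,y) = √(1+m²)/(m²x+y) satisfy all three equations (E1), (E2), (E3) of the system (S_ε) with ε = −1. -/

import Mathlib

noncomputable section

/-- Partial derivative with respect to the first coordinate. -/
def pdx (f : ℝ × ℝ → ℝ) (p : ℝ × ℝ) : ℝ := deriv (fun t => f (t, p.2)) p.1

/-- Partial derivative with respect to the second coordinate. -/
def pdy (f : ℝ × ℝ → ℝ) (p : ℝ × ℝ) : ℝ := deriv (fun t => f (p.1, t)) p.2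

/-- Equation (E1):  ∂ₓ(k/f) + ∂_y(f/k) = 0  at the point `p`. -/
def E1 (f k : ℝ × ℝ → ℝ) (p : ℝ × ℝ) : Prop :=
  pdx (fun q => k q / f q) p + pdy (fun q => f q / k q) p = 0

/-- Equation (E2):  (∂_y f)/k = (∂ₓ k)/f  at the point `p`. -/
def E2 (f k : ℝ × ℝ → ℝ) (p : ℝ × ℝ) : Prop :=
  pdy f p / k p = pdx k p / f p

/-- Equation (E3):  ∂_y((∂_y f)/k) + ∂ₓ((∂ₓ k)/f) = −ε·f·k  at the point `p`. -/
def E3 (ε : ℝ) (f k : ℝ × ℝ → ℝ) (p : ℝ × ℝ) : Prop :=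
  pdy (fun q => pdy f q / k q) p + pdx (fun q => pdx k q / f q) p = -ε * f p * k p

theorem deriv_aux (c a b t : ℝ) (h : a * t + b ≠ 0) :
    HasDerivAt (fun u : ℝ => c / (a * u + b)) (-(c * a) / (a * t + b) ^ 2) t := by
  have h1 : HasDerivAt (fun u : ℝ => a * u + b) a t := by
    simpa using ((hasDerivAt_id t).const_mul a).add_const b
  have h2 := (hasDerivAt_const t c).fun_div h1 h
  have e : -(c * a) / (a * t + b) ^ 2 = (0 * (a * t + b) - c * a) / (a * t + b) ^ 2 := by ring
  rw [e]
  exact h2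

theorem deriv_aux_const (g : ℝ → ℝ) (c a b t : ℝ) (h : a * t + b ≠ 0)
    (hg : ∀ u, a * u + b ≠ 0 → g u = c) : deriv g t = 0 := by
  have hc : ContinuousAt (fun u : ℝ => a * u + b) t := by fun_prop
  have he : g =ᶠ[nhds t] fun _ => c := by
    filter_upwards [hc.eventually_ne h] with u hu using hg u hu
  rw [he.deriv_eq]
  simp

/-- For `m > 0`, `m ≠ 1`, on the open set where `m²x + y > 0`, the functions
`f = m√(1+m²)/(m²x+y)` and `k = √(1+m²)/(m²x+y)` satisfy (E1), (E2), (E3) with ε = −1. -/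
theorem stmt_9 (m : ℝ) (hm : 0 < m) (hm1 : m ≠ 1) :
    let f : ℝ × ℝ → ℝ := fun p => m * Real.sqrt (1 + m ^ 2) / (m ^ 2 * p.1 + p.2)
    let k : ℝ × ℝ → ℝ := fun p => Real.sqrt (1 + m ^ 2) / (m ^ 2 * p.1 + p.2)
    ∀ p : ℝ × ℝ, 0 < m ^ 2 * p.1 + p.2 →
      E1 f k p ∧ E2 f k p ∧ E3 (-1) f k p := by
  intro f k p hp
  have hs : Real.sqrt (1 + m ^ 2) ^ 2 = 1 + m ^ 2 := Real.sq_sqrt (by positivity)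
  have hs0 : Real.sqrt (1 + m ^ 2) ≠ 0 := by positivity
  have hm0 : m ≠ 0 := hm.ne'
  have hfy : ∀ q : ℝ × ℝ, m ^ 2 * q.1 + q.2 ≠ 0 →
      pdy f q = -(m * Real.sqrt (1 + m ^ 2)) / (m ^ 2 * q.1 + q.2) ^ 2 := by
    intro q hq
    have h := (deriv_aux (m * Real.sqrt (1 + m ^ 2)) 1 (m ^ 2 * q.1) q.2
      (by rwa [one_mul, add_comm])).deriv
    simp only [one_mul, mul_one, add_comm _ (m ^ 2 * q.1)] at h
    exact h
  have hkx : ∀ q : ℝ × ℝ, m ^ 2 * q.1 + q.2 ≠ 0 →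
      pdx k q = -(Real.sqrt (1 + m ^ 2) * m ^ 2) / (m ^ 2 * q.1 + q.2) ^ 2 := by
    intro q hq
    exact (deriv_aux (Real.sqrt (1 + m ^ 2)) (m ^ 2) q.2 q.1 hq).deriv
  have hA : ∀ q : ℝ × ℝ, pdy f q / k q = -m / (m ^ 2 * q.1 + q.2) := by
    intro q
    by_cases hq : m ^ 2 * q.1 + q.2 = 0
    · simp [k, hq]
    · rw [hfy q hq]
      simp only [k]
      field_simp
  have hB : ∀ q : ℝ × ℝ, pdx k q / f q = -m / (m ^ 2 * q.1 + q.2) := by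
    intro q
    by_cases hq : m ^ 2 * q.1 + q.2 = 0
    · simp [f, hq]
    · rw [hkx q hq]
      simp only [f]
      field_simp
  refine ⟨?_, ?_, ?_⟩
  · have h1 : pdx (fun q => k q / f q) p = 0 := by
      refine deriv_aux_const _ (1 / m) (m ^ 2) p.2 p.1 hp.ne' ?_
      intro u hu
      simp only [f, k]
      field_simp
    have h2 : pdy (fun q => f q / k q) p = 0 := by
      refine deriv_aux_const _ m 1 (m ^ 2 * p.1) p.2 (by rw [one_mul, add_comm]; exact hp.ne') ?_
      intro u hu
      rw [one_mul, add_comm] at hu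
      simp only [f, k]
      field_simp
    unfold E1
    rw [h1, h2, add_zero]
  · unfold E2
    rw [hA, hB]
  · unfold E3
    simp only [hA, hB]
    have h1 : pdx (fun q => -m / (m ^ 2 * q.1 + q.2)) p
        = -(-m * m ^ 2) / (m ^ 2 * p.1 + p.2) ^ 2 :=
      (deriv_aux (-m) (m ^ 2) p.2 p.1 hp.ne').deriv
    have h2 : pdy (fun q => -m / (m ^ 2 * q.1 + q.2)) p
        = m / (m ^ 2 * p.1 + p.2) ^ 2 := by
      have h := (deriv_aux (-m) 1 (m ^ 2 * p.1) p.2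
        (by rw [one_mul, add_comm]; exact hp.ne')).deriv
      simp only [one_mul, mul_one, neg_neg, add_comm _ (m ^ 2 * p.1)] at h
      exact h
    rw [h1, h2]
    have h3 : -(-1) * f p * k p
        = m * Real.sqrt (1 + m ^ 2) ^ 2 / (m ^ 2 * p.1 + p.2) ^ 2 := by
      simp only [f, k]
      field_simp
    rw [h3, hs]
    ring
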